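/- arXiv:2211.10523 — 2 statements merged into one kernel-verified Lean document; each statement's English description precedes it below -/
import Mathlib

section
/- For every real number $s$ with $0 < s < 1$, one has $K(1-1/s^2) - s^2 E(1-1/s^2) > 0$. -/
open MeasureTheory

/-- Complete elliptic integral of the second kind, `E(k) = ∫₀¹ √(1-kt²)/√(1-t²) dt`. -/
noncomputable def ellipticE (k : ℝ) : ℝ :=
  ∫ t in (0:ℝ)..1, Real.sqrt (1 - k * t ^ 2) / Real.sqrt (1 - t ^ 2)

/-- Complete elliptic integral of the first kind, `K(k) = ∫₀¹ dt/√((1-t²)(1-kt²))`. -/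
noncomputable def ellipticK (k : ℝ) : ℝ :=
  ∫ t in (0:ℝ)..1, 1 / Real.sqrt ((1 - t ^ 2) * (1 - k * t ^ 2))

theorem intervalIntegrable_inv_sqrt_one_sub_sq :
    IntervalIntegrable (fun t : ℝ => (√(1 - t ^ 2))⁻¹) volume 0 1 := by
  refine intervalIntegral.intervalIntegrable_deriv_of_nonneg (g := Real.arcsin)
    Real.continuous_arcsin.continuousOn (fun t ht => ?_) (fun t _ => by positivity)
  rw [min_eq_left zero_le_one, max_eq_right zero_le_one] at ht
  rw [← one_div]
  exact Real.hasDerivAt_arcsin (by linarith [ht.1]) ht.2.ne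

theorem continuous_sqrt_one_sub_mul_sq (k : ℝ) : Continuous fun t : ℝ => √(1 - k * t ^ 2) := by
  fun_prop

theorem one_sub_mul_sq_pos {k : ℝ} (hk : k ≤ 0) (t : ℝ) : 0 < 1 - k * t ^ 2 := by
  nlinarith [mul_nonneg (neg_nonneg.2 hk) (sq_nonneg t)]

theorem continuous_inv_sqrt_one_sub_mul_sq {k : ℝ} (hk : k ≤ 0) :
    Continuous fun t : ℝ => (√(1 - k * t ^ 2))⁻¹ :=
  (continuous_sqrt_one_sub_mul_sq k).inv₀ fun t => (Real.sqrt_pos.2 (one_sub_mul_sq_pos hk t)).ne'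

theorem intervalIntegrable_ellipticE (k : ℝ) :
    IntervalIntegrable (fun t : ℝ => √(1 - k * t ^ 2) / √(1 - t ^ 2)) volume 0 1 := by
  simpa only [div_eq_mul_inv] using intervalIntegrable_inv_sqrt_one_sub_sq.continuousOn_mul
    (continuous_sqrt_one_sub_mul_sq k).continuousOn

theorem intervalIntegrable_ellipticK {k : ℝ} (hk : k ≤ 0) :
    IntervalIntegrable (fun t : ℝ => 1 / √((1 - t ^ 2) * (1 - k * t ^ 2))) volume 0 1 := by
  have h := intervalIntegrable_inv_sqrt_one_sub_sq.continuousOn_mul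
    (continuous_inv_sqrt_one_sub_mul_sq hk).continuousOn
  simpa only [one_div, Real.sqrt_mul' _ (one_sub_mul_sq_pos hk _).le, mul_inv_rev] using h

/-- For `0 < s < 1`, one has `K(1-1/s²) - s²E(1-1/s²) > 0`. -/
theorem ellipticK_sub_sq_mul_ellipticE_pos (s : ℝ) (hs0 : 0 < s) (hs1 : s < 1) :
    0 < ellipticK (1 - 1 / s ^ 2) - s ^ 2 * ellipticE (1 - 1 / s ^ 2) := by
  have hs2 : s ^ 2 < 1 := by nlinarith
  have hk : 1 - 1 / s ^ 2 ≤ 0 := by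
    rw [sub_nonpos, le_div_iff₀ (by positivity)]
    linarith
  have hsk : s ^ 2 * (1 - 1 / s ^ 2) = s ^ 2 - 1 := by field_simp
  rw [ellipticK, ellipticE, ← intervalIntegral.integral_const_mul,
    ← intervalIntegral.integral_sub (intervalIntegrable_ellipticK hk)
      ((intervalIntegrable_ellipticE _).const_mul _)]
  refine intervalIntegral.intervalIntegral_pos_of_pos_on
    ((intervalIntegrable_ellipticK hk).sub ((intervalIntegrable_ellipticE _).const_mul _))
    (fun t ht => ?_) zero_lt_one
  have ht2 : t ^ 2 < 1 := by nlinarith [ht.1, ht.2]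
  generalize 1 - 1 / s ^ 2 = k at hk hsk ⊢
  have hkt := one_sub_mul_sq_pos hk t
  have hp : 0 < √(1 - t ^ 2) := Real.sqrt_pos.2 (by linarith)
  have hq : 0 < √(1 - k * t ^ 2) := Real.sqrt_pos.2 hkt
  have hlt : s ^ 2 * (1 - k * t ^ 2) < 1 := by
    have : s ^ 2 * (1 - k * t ^ 2) = s ^ 2 - (s ^ 2 - 1) * t ^ 2 := by rw [← hsk]; ring
    nlinarith
  have heq : 1 / (√(1 - t ^ 2) * √(1 - k * t ^ 2)) -
      s ^ 2 * (√(1 - k * t ^ 2) / √(1 - t ^ 2)) =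
      (1 - s ^ 2 * √(1 - k * t ^ 2) ^ 2) / (√(1 - t ^ 2) * √(1 - k * t ^ 2)) := by
    field_simp
  rw [Real.sqrt_mul' _ hkt.le, heq, Real.sq_sqrt hkt.le]
  exact div_pos (by linarith) (mul_pos hp hq)
end

section
/- As $s \to 0^+$, one has $s \cdot K(1-1/s^2) \to 0$, i.e. the limit of $s\,K(1-1/s^2)$ as $s$ tends to $0$ from the right equals $0$. -/
open MeasureTheory Filter

theorem intervalIntegrable_one_div_sqrt_one_sub_sq :
    IntervalIntegrable (fun t : ℝ => 1 / Real.sqrt (1 - t ^ 2)) volume 0 1 := by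
  refine intervalIntegral.intervalIntegrable_deriv_of_nonneg (g := Real.arcsin)
    Real.continuous_arcsin.continuousOn (fun t ht => ?_) (fun t _ => by positivity)
  simp only [zero_le_one, min_eq_left, max_eq_right, Set.mem_Ioo] at ht
  exact Real.hasDerivAt_arcsin (by linarith) (by linarith)

theorem abs_ellipticK_le {k : ℝ} (hk : k ≤ 0) :
    |ellipticK k| ≤ ∫ t in (0:ℝ)..1, 1 / Real.sqrt (1 - t ^ 2) := by
  have hae : ∀ᵐ t : ℝ ∂volume, t ≠ 1 := by simp [ae_iff]
  rw [← Real.norm_eq_abs, ellipticK]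
  refine intervalIntegral.norm_integral_le_of_norm_le zero_le_one ?_
    intervalIntegrable_one_div_sqrt_one_sub_sq
  filter_upwards [hae] with t ht1 ht
  have hlt : t < 1 := lt_of_le_of_ne ht.2 ht1
  have hpos : 0 < 1 - t ^ 2 := by nlinarith [ht.1]
  rw [Real.norm_of_nonneg (by positivity)]
  refine one_div_le_one_div_of_le (Real.sqrt_pos.2 hpos) (Real.sqrt_le_sqrt ?_)
  nlinarith [mul_nonneg (neg_nonneg.2 hk) (sq_nonneg t)]

/-- As `s → 0⁺`, `s · K(1-1/s²) → 0`. -/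
theorem tendsto_mul_ellipticK :
    Tendsto (fun s : ℝ => s * ellipticK (1 - 1 / s ^ 2))
      (nhdsWithin 0 (Set.Ioi 0)) (nhds 0) := by
  refine Tendsto.zero_mul_isBoundedUnder_le (tendsto_id.mono_left nhdsWithin_le_nhds)
    (isBoundedUnder_of_eventually_le (a := ∫ t in (0:ℝ)..1, 1 / Real.sqrt (1 - t ^ 2)) ?_)
  filter_upwards [Ioo_mem_nhdsGT (zero_lt_one' ℝ)] with s hs
  refine abs_ellipticK_le (sub_nonpos.2 ?_)
  exact one_le_one_div (pow_pos hs.1 2) (pow_le_one₀ hs.1.le hs.2.le)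
end
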